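/- arXiv:1907.03275 — 9 statements merged into one kernel-verified Lean document; each statement's English description precedes it below -/
import Mathlib

section
/- Let D = (E, 𝓕) be a delta-matroid that is not binary. Then there exist n ≥ 1 and elements a₁, b₁, …, aₙ, bₙ ∈ E with aᵢ ≠ bᵢ for each i such that the iterated handle slide (⋯((D_{a₁b₁})_{a₂b₂})⋯)_{aₙbₙ} is not a delta-matroid. Consequently, the only class of delta-matroids closed under handle slides is the class of binary delta-matroids. -/
/-- A set system: a finite ground set `E` together with a collection `F`
of finite subsets (intended to be subsets of `E`). -/
structure SetSystem (α : Type*) where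
  E : Finset α
  F : Set (Finset α)

namespace SetSystem

variable {α : Type*} [DecidableEq α]

/-- A delta-matroid: a set system with nonempty feasible collection, all feasible
sets contained in the ground set, satisfying the symmetric exchange axiom. -/
def IsDeltaMatroid (D : SetSystem α) : Prop :=
  D.F.Nonempty ∧ (∀ F ∈ D.F, F ⊆ D.E) ∧
    ∀ F₁ ∈ D.F, ∀ F₂ ∈ D.F, ∀ x ∈ symmDiff F₁ F₂,
      ∃ y ∈ symmDiff F₁ F₂, symmDiff F₁ {x, y} ∈ D.F

/-- The handle slide taking `a` over `b`:
`𝓕_{ab} = 𝓕 Δ {X ∪ {a} : X ⊆ E − {a,b}, X ∪ {b} ∈ 𝓕}`. -/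
def slide (D : SetSystem α) (a b : α) : SetSystem α :=
  ⟨D.E, symmDiff D.F
    {Y : Finset α | ∃ X : Finset α, X ⊆ D.E \ {a, b} ∧ X ∪ {b} ∈ D.F ∧ Y = X ∪ {a}}⟩

/-- Iterated handle slides along a list of pairs. -/
def slides (D : SetSystem α) : List (α × α) → SetSystem α
  | [] => D
  | (a, b) :: L => slides (D.slide a b) L

/-- The twist `D ⋆ A = (E, {A Δ X : X ∈ 𝓕})`. -/
def twist (D : SetSystem α) (A : Finset α) : SetSystem α :=
  ⟨D.E, {Y : Finset α | ∃ X ∈ D.F, Y = symmDiff A X}⟩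

/-- Deletion of `e`: `D − e = (E − e, {F : F ⊆ E − e, F ∈ 𝓕})`. -/
def del (D : SetSystem α) (e : α) : SetSystem α :=
  ⟨D.E.erase e, {F : Finset α | F ⊆ D.E.erase e ∧ F ∈ D.F}⟩

/-- Contraction of `e`: `D/e = (E − e, {F : F ⊆ E − e, F ∪ {e} ∈ 𝓕})`. -/
def contr (D : SetSystem α) (e : α) : SetSystem α :=
  ⟨D.E.erase e, {F : Finset α | F ⊆ D.E.erase e ∧ F ∪ {e} ∈ D.F}⟩

/-- The set system `D(A)` of a symmetric binary matrix `A` indexed by `E`: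
feasible sets are the `W ⊆ E` whose principal submatrix `A[W]` is invertible
(the empty submatrix being invertible by convention). -/
def ofMatrix (E : Finset α) (A : Matrix E E (ZMod 2)) : SetSystem α :=
  ⟨E, {W : Finset α | ∃ h : ∀ x ∈ W, x ∈ E,
        IsUnit (Matrix.submatrix A
          (fun i : W => (⟨i.1, h i.1 i.2⟩ : E)) (fun i : W => (⟨i.1, h i.1 i.2⟩ : E)))}⟩

/-- `D` is binary: `D = D(A) ⋆ F` for some feasible `F ∈ 𝓕` and some
symmetric matrix `A` over GF(2) indexed by the ground set. -/
def IsBinary (D : SetSystem α) : Prop :=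
  ∃ F ∈ D.F, ∃ A : Matrix D.E D.E (ZMod 2),
    A.IsSymm ∧ D = (ofMatrix D.E A).twist F

/-- `IsMinor D T`: `T` is obtained from `D` by a sequence of deletions and
contractions (keeping feasible collections nonempty). -/
inductive IsMinor : SetSystem α → SetSystem α → Prop
  | refl (D : SetSystem α) : IsMinor D D
  | del {D T : SetSystem α} (e : α) (he : e ∈ D.E) (hne : (D.del e).F.Nonempty)
      (h : IsMinor (D.del e) T) : IsMinor D T
  | contr {D T : SetSystem α} (e : α) (he : e ∈ D.E) (hne : (D.contr e).F.Nonempty)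
      (h : IsMinor (D.contr e) T) : IsMinor D T

/-- Isomorphism of set systems: a bijection of ground sets carrying one
feasible collection onto the other. -/
def Isomorphic {β : Type*} [DecidableEq β] (D : SetSystem α) (D' : SetSystem β) : Prop :=
  ∃ φ : α → β, Set.InjOn φ D.E ∧ D.E.image φ = D'.E ∧
    D'.F = {Y : Finset β | ∃ X ∈ D.F, Y = X.image φ}

end SetSystem

open SetSystem

/-- The minimal non-binary delta-matroids of Bouchet–Duchamp. -/
def S₁ : SetSystem ℕ := ⟨{1, 2, 3}, {∅, {1, 2}, {1, 3}, {2, 3}, {1, 2, 3}}⟩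
def S₂ : SetSystem ℕ := ⟨{1, 2, 3}, {∅, {1}, {2}, {3}, {1, 2}, {1, 3}, {2, 3}}⟩
def S₃ : SetSystem ℕ := ⟨{1, 2, 3}, {∅, {2}, {3}, {1, 2}, {1, 3}, {1, 2, 3}}⟩
def S₄ : SetSystem ℕ := ⟨{1, 2, 3, 4}, {∅, {1, 2}, {1, 3}, {1, 4}, {2, 3}, {2, 4}, {3, 4}}⟩
def S₅ : SetSystem ℕ := ⟨{1, 2, 3, 4}, {∅, {1, 2}, {1, 4}, {2, 3}, {3, 4}, {1, 2, 3, 4}}⟩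

namespace SetSystem

/-! ### Tables of feasibility bits

A face of the cube of subsets is encoded by `n` directions and a base set; its vertices are the
bit masks `s < 2 ^ n`. The restriction of a set system to a face is a list of `2 ^ n` bits. -/

/-- The handle slide of direction `a` over direction `b`, on tables of length `2 ^ n`. -/
def slideTable (n a b : ℕ) (l : List Bool) : List Bool :=
  (List.range (2 ^ n)).map fun s =>
    xor (l.getD s false) (s.testBit a && !s.testBit b && l.getD (s ^^^ (2 ^ a ||| 2 ^ b)) false)

/-- The symmetric exchange axiom for tables of length `2 ^ n`. -/
def exchangeTable (n : ℕ) (l : List Bool) : Bool :=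
  (List.range (2 ^ n)).all fun s => !l.getD s false ||
    (List.range (2 ^ n)).all fun t => !l.getD t false ||
      (List.range n).all fun x => !(s ^^^ t).testBit x ||
        (List.range n).any fun y => (s ^^^ t).testBit y && l.getD (s ^^^ (2 ^ x ||| 2 ^ y)) false

/-- The three-term Wick relations for a table of length `8`. -/
def wickTable₃ (l : List Bool) : Bool :=
  (List.range 8).all fun s => !l.getD s false || (l.getD (s ^^^ 7) false ==
    xor (xor (l.getD (s ^^^ 1) false && l.getD (s ^^^ 6) false)
      (l.getD (s ^^^ 2) false && l.getD (s ^^^ 5) false))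
      (l.getD (s ^^^ 4) false && l.getD (s ^^^ 3) false))

/-- The four-term Wick relations for a table of length `16` supported on a single parity. -/
def wickTable₄ (l : List Bool) : Bool :=
  (List.range 16).all fun s => !l.getD s false || (l.getD (s ^^^ 15) false ==
    xor (xor (l.getD (s ^^^ 3) false && l.getD (s ^^^ 12) false)
      (l.getD (s ^^^ 5) false && l.getD (s ^^^ 10) false))
      (l.getD (s ^^^ 9) false && l.getD (s ^^^ 6) false))

theorem wickTable₃_of_exchange : ∀ a b c d e f g h : Bool,
    exchangeTable 3 [a, b, c, d, e, f, g, h] = true →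
    exchangeTable 3 (slideTable 3 2 0 [a, b, c, d, e, f, g, h]) = true →
    exchangeTable 3 (slideTable 3 0 1 [a, b, c, d, e, f, g, h]) = true →
    exchangeTable 3 (slideTable 3 1 2 [a, b, c, d, e, f, g, h]) = true →
    wickTable₃ [a, b, c, d, e, f, g, h] = true := by
  decide +kernel

theorem wickTable₄_of_exchange_even : ∀ a b c d e f g h : Bool,
    ∀ l, l = [a, false, false, b, false, c, d, false, false, e, f, false, g, false, false, h] →
    exchangeTable 4 l = true →
    exchangeTable 4 (slideTable 4 3 2 l) = true →
    exchangeTable 4 (slideTable 4 2 0 l) = true →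
    exchangeTable 4 (slideTable 4 3 0 l) = true →
    wickTable₄ l = true := by
  simp only [forall_eq]
  decide +kernel

theorem wickTable₄_of_exchange_odd : ∀ a b c d e f g h : Bool,
    ∀ l, l = [false, a, b, false, c, false, false, d, e, false, false, f, false, g, h, false] →
    exchangeTable 4 l = true →
    exchangeTable 4 (slideTable 4 3 2 l) = true →
    exchangeTable 4 (slideTable 4 0 1 l) = true →
    wickTable₄ l = true := by
  simp only [forall_eq]
  decide +kernel

end SetSystem

namespace SetSystem

variable {α : Type*} [DecidableEq α]

/-! ### Faces of the cube of subsets -/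

/-- The set of directions selected by the bit mask `s`. -/
def maskSet {n : ℕ} (ι : Fin n → α) (s : ℕ) : Finset α :=
  (Finset.univ.filter fun i : Fin n => s.testBit i = true).image ι

theorem mem_maskSet {n : ℕ} {ι : Fin n → α} {s : ℕ} {z : α} :
    z ∈ maskSet ι s ↔ ∃ i : Fin n, s.testBit i = true ∧ ι i = z := by
  simp [maskSet]

theorem apply_mem_maskSet {n : ℕ} {ι : Fin n → α} (hι : Function.Injective ι) {s : ℕ}
    {i : Fin n} : ι i ∈ maskSet ι s ↔ s.testBit i = true := by
  simp [mem_maskSet, hι.eq_iff]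

theorem maskSet_xor {n : ℕ} {ι : Fin n → α} (hι : Function.Injective ι) (s t : ℕ) :
    maskSet ι (s ^^^ t) = symmDiff (maskSet ι s) (maskSet ι t) := by
  ext z
  by_cases hz : ∃ i, ι i = z
  · obtain ⟨i, rfl⟩ := hz
    rw [Finset.mem_symmDiff]
    simp only [apply_mem_maskSet hι, Nat.testBit_xor]
    cases s.testBit i <;> cases t.testBit i <;> simp
  · have h (u : ℕ) : z ∉ maskSet ι u := fun hu => hz ((mem_maskSet.1 hu).imp fun _ h => h.2)
    simp [Finset.mem_symmDiff, h]

theorem maskSet_pair {n : ℕ} {ι : Fin n → α} (i j : Fin n) :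
    maskSet ι (2 ^ (i : ℕ) ||| 2 ^ (j : ℕ)) = {ι i, ι j} := by
  ext z
  simp only [mem_maskSet, Nat.testBit_or, Nat.testBit_two_pow, Finset.mem_insert,
    Finset.mem_singleton, Bool.or_eq_true, decide_eq_true_eq, Fin.val_inj]
  constructor
  · rintro ⟨k, rfl | rfl, rfl⟩ <;> simp
  · rintro (rfl | rfl)
    exacts [⟨i, by simp⟩, ⟨j, by simp⟩]

theorem symmDiff_union_maskSet {n : ℕ} {ι : Fin n → α} (hι : Function.Injective ι)
    {X : Finset α} (hX : ∀ i, ι i ∉ X) (s t : ℕ) :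
    symmDiff (X ∪ maskSet ι s) (maskSet ι t) = X ∪ maskSet ι (s ^^^ t) := by
  rw [maskSet_xor hι]
  ext z
  have h (u : ℕ) : z ∈ maskSet ι u → z ∉ X := fun hu => by
    obtain ⟨i, -, rfl⟩ := mem_maskSet.1 hu
    exact hX i
  have h1 := h s
  have h2 := h t
  simp only [Finset.mem_symmDiff, Finset.mem_union]
  tauto

theorem symmDiff_union_maskSet_union_maskSet {n : ℕ} {ι : Fin n → α}
    (hι : Function.Injective ι) {X : Finset α} (hX : ∀ i, ι i ∉ X) (s t : ℕ) :
    symmDiff (X ∪ maskSet ι s) (X ∪ maskSet ι t) = maskSet ι (s ^^^ t) := by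
  rw [← symmDiff_symmDiff_cancel_left (X ∪ maskSet ι s) (maskSet ι (s ^^^ t)),
    symmDiff_union_maskSet hι hX, ← Nat.xor_assoc, Nat.xor_self, Nat.zero_xor]

theorem exists_eq_union_maskSet {n : ℕ} {ι : Fin n → α} (hι : Function.Injective ι)
    (F : Finset α) : ∃ X : Finset α, (∀ i, ι i ∉ X) ∧
      ∃ s < 2 ^ n, F = X ∪ maskSet ι s := by
  refine ⟨F \ Finset.univ.image ι, by simp,
    Nat.ofBits fun i => decide (ι i ∈ F), Nat.ofBits_lt_two_pow _, ?_⟩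
  ext z
  by_cases hz : ∃ i, ι i = z
  · obtain ⟨i, rfl⟩ := hz
    simp [apply_mem_maskSet hι]
  · have h (u : ℕ) : z ∉ maskSet ι u := fun hu => hz ((mem_maskSet.1 hu).imp fun _ h => h.2)
    push Not at hz
    simp [h, hz]

theorem mem_slide_iff {D : SetSystem α} (hE : ∀ F ∈ D.F, F ⊆ D.E) {a b : α} (hab : a ≠ b)
    {Y : Finset α} :
    Y ∈ (D.slide a b).F ↔ Xor (Y ∈ D.F) (a ∈ Y ∧ b ∉ Y ∧ symmDiff Y {a, b} ∈ D.F) := by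
  have key : (∃ X : Finset α, X ⊆ D.E \ {a, b} ∧ X ∪ {b} ∈ D.F ∧ Y = X ∪ {a}) ↔
      (a ∈ Y ∧ b ∉ Y ∧ symmDiff Y {a, b} ∈ D.F) := by
    constructor
    · rintro ⟨X, hX, hXb, rfl⟩
      have ha : a ∉ X := fun h => by simpa using hX h
      have hb : b ∉ X := fun h => by simpa using hX h
      refine ⟨by simp, by simp [hb, hab.symm], ?_⟩
      convert hXb using 1
      ext z
      simp only [Finset.mem_symmDiff, Finset.mem_union, Finset.mem_insert, Finset.mem_singleton]
      by_cases hza : z = a <;> by_cases hzb : z = b <;> simp_all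
    · rintro ⟨ha, hb, h⟩
      have hEq : Y.erase a ∪ {b} = symmDiff Y {a, b} := by
        ext z
        simp only [Finset.mem_symmDiff, Finset.mem_union, Finset.mem_insert,
          Finset.mem_singleton, Finset.mem_erase]
        by_cases hza : z = a <;> by_cases hzb : z = b <;> simp_all
      refine ⟨Y.erase a, fun z hz => ?_, hEq ▸ h, ?_⟩
      · have hzY := Finset.mem_of_mem_erase hz
        have hz' : z ∈ symmDiff Y {a, b} := hEq ▸ Finset.mem_union_left _ hz
        have hzb : z ≠ b := fun h => hb (h ▸ hzY)
        simp [hE _ h hz', Finset.ne_of_mem_erase hz, hzb]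
      · ext z
        by_cases hza : z = a <;> simp_all
  rw [← key]
  rfl

open Classical in
/-- The feasibility table of a face. -/
noncomputable def table (D : SetSystem α) {n : ℕ} (ι : Fin n → α) (X : Finset α) : List Bool :=
  (List.range (2 ^ n)).map fun s => decide (X ∪ maskSet ι s ∈ D.F)

theorem getD_map_range {N s : ℕ} (f : ℕ → Bool) (hs : s < N) :
    ((List.range N).map f).getD s false = f s := by
  simp [List.getD_eq_getElem?_getD, hs]

open Classical in
theorem getD_table (D : SetSystem α) {n : ℕ} (ι : Fin n → α) (X : Finset α) {s : ℕ}
    (hs : s < 2 ^ n) : (D.table ι X).getD s false = decide (X ∪ maskSet ι s ∈ D.F) :=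
  getD_map_range _ hs

theorem two_pow_or_two_pow_lt {n : ℕ} (i j : Fin n) : 2 ^ (i : ℕ) ||| 2 ^ (j : ℕ) < 2 ^ n :=
  Nat.or_lt_two_pow (Nat.pow_lt_pow_right (by norm_num) i.2)
    (Nat.pow_lt_pow_right (by norm_num) j.2)

theorem table_slide {D : SetSystem α} (hE : ∀ F ∈ D.F, F ⊆ D.E) {n : ℕ} {ι : Fin n → α}
    (hι : Function.Injective ι) {X : Finset α} (hX : ∀ i, ι i ∉ X) {i j : Fin n} (hij : i ≠ j) :
    (D.slide (ι i) (ι j)).table ι X = slideTable n i j (D.table ι X) := by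
  classical
  refine List.map_congr_left fun s hs => ?_
  rw [List.mem_range] at hs
  rw [getD_table _ _ _ hs, getD_table _ _ _ (Nat.xor_lt_two_pow hs (two_pow_or_two_pow_lt i j)),
    Bool.eq_iff_iff, decide_eq_true_iff, mem_slide_iff hE (hι.ne hij), ← maskSet_pair,
    symmDiff_union_maskSet hι hX]
  simp only [Finset.mem_union, hX, apply_mem_maskSet hι, false_or, Xor]
  by_cases h1 : X ∪ maskSet ι s ∈ D.F <;> cases s.testBit i <;> cases s.testBit j <;> simp [h1]

theorem IsDeltaMatroid.exchangeTable_table {D : SetSystem α} (hD : D.IsDeltaMatroid) {n : ℕ}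
    {ι : Fin n → α} (hι : Function.Injective ι) {X : Finset α} (hX : ∀ i, ι i ∉ X) :
    exchangeTable n (D.table ι X) = true := by
  classical
  simp only [exchangeTable, List.all_eq_true, List.any_eq_true, List.mem_range, Bool.or_eq_true,
    Bool.and_eq_true, Bool.not_eq_true', ← Bool.not_eq_true, ← imp_iff_not_or]
  intro s hs hs' t ht ht' x hx hx'
  rw [getD_table _ _ _ hs, decide_eq_true_iff] at hs'
  rw [getD_table _ _ _ ht, decide_eq_true_iff] at ht'
  lift x to Fin n using hx
  obtain ⟨y, hy, hy'⟩ := hD.2.2 _ hs' _ ht' (ι x) (by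
    rwa [symmDiff_union_maskSet_union_maskSet hι hX, apply_mem_maskSet hι])
  rw [symmDiff_union_maskSet_union_maskSet hι hX] at hy
  obtain ⟨j, hj, rfl⟩ := mem_maskSet.1 hy
  refine ⟨j, j.2, hj, ?_⟩
  rwa [getD_table _ _ _ (Nat.xor_lt_two_pow hs (two_pow_or_two_pow_lt x j)),
    decide_eq_true_iff, ← symmDiff_union_maskSet hι hX, maskSet_pair]

end SetSystem

namespace SetSystem

variable {α : Type*} [DecidableEq α]

/-! ### Wick relations -/

open Classical in
/-- The indicator, with values in `ZMod 2`, of feasibility in the twist of `D` by `F`. -/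
noncomputable def ind (D : SetSystem α) (F W : Finset α) : ZMod 2 :=
  if symmDiff F W ∈ D.F then 1 else 0

theorem ind_eq_one {D : SetSystem α} {F W : Finset α} (h : symmDiff F W ∈ D.F) :
    D.ind F W = 1 := if_pos h

theorem ind_eq_zero {D : SetSystem α} {F W : Finset α} (h : symmDiff F W ∉ D.F) :
    D.ind F W = 0 := if_neg h

theorem ind_ne_zero_iff {D : SetSystem α} {F W : Finset α} :
    D.ind F W ≠ 0 ↔ symmDiff F W ∈ D.F := by
  by_cases h : symmDiff F W ∈ D.F <;> simp [ind, h]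

theorem ind_symmDiff (D : SetSystem α) (F S W : Finset α) :
    D.ind (symmDiff F S) W = D.ind F (symmDiff S W) := by
  rw [ind, ind, symmDiff_assoc]

theorem ind_maskSet (D : SetSystem α) {n : ℕ} {ι : Fin n → α} (hι : Function.Injective ι)
    {X : Finset α} (hX : ∀ i, ι i ∉ X) {s t : ℕ} (hs : s < 2 ^ n) (ht : t < 2 ^ n) :
    D.ind (X ∪ maskSet ι s) (maskSet ι t) =
      if (D.table ι X).getD (s ^^^ t) false = true then 1 else 0 := by
  rw [ind, getD_table _ _ _ (Nat.xor_lt_two_pow hs ht), symmDiff_union_maskSet hι hX]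
  by_cases h : X ∪ maskSet ι (s ^^^ t) ∈ D.F <;> simp [h]

/-- A delta-matroid all of whose single handle slides are delta-matroids. -/
def IsSlideStable (D : SetSystem α) : Prop :=
  D.IsDeltaMatroid ∧ ∀ a ∈ D.E, ∀ b ∈ D.E, a ≠ b → (D.slide a b).IsDeltaMatroid

theorem IsSlideStable.exchangeTable_slideTable {D : SetSystem α} (hD : D.IsSlideStable) {n : ℕ}
    {ι : Fin n → α} (hι : Function.Injective ι) (hιE : ∀ i, ι i ∈ D.E) {X : Finset α}
    (hX : ∀ i, ι i ∉ X) {i j : Fin n} (hij : i ≠ j) :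
    exchangeTable n (slideTable n i j (D.table ι X)) = true := by
  rw [← table_slide hD.1.2.1 hι hX hij]
  exact (hD.2 _ (hιE i) _ (hιE j) (hι.ne hij)).exchangeTable_table hι hX

theorem ite_bool_xor_and (x p q r s t u : Bool)
    (h : x = xor (xor (p && q) (r && s)) (t && u)) :
    (if x = true then 1 else 0 : ZMod 2) =
      (if p = true then 1 else 0) * (if q = true then 1 else 0) +
      (if r = true then 1 else 0) * (if s = true then 1 else 0) +
      (if t = true then 1 else 0) * (if u = true then 1 else 0) := by
  decide +revert

theorem IsSlideStable.ind_triple {D : SetSystem α} (hD : D.IsSlideStable) {F : Finset α}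
    (hF : F ∈ D.F) {a b c : α} (ha : a ∈ D.E) (hb : b ∈ D.E) (hc : c ∈ D.E) (hab : a ≠ b)
    (hac : a ≠ c) (hbc : b ≠ c) :
    D.ind F {a, b, c} = D.ind F {a} * D.ind F {b, c} + D.ind F {b} * D.ind F {a, c} +
      D.ind F {c} * D.ind F {a, b} := by
  have hι : Function.Injective ![a, b, c] := by
    intro i j; fin_cases i <;> fin_cases j <;> simp_all [eq_comm]
  have hιE : ∀ i, ![a, b, c] i ∈ D.E := by intro i; fin_cases i <;> simpa
  obtain ⟨X, hX, s, hs, rfl⟩ := exists_eq_union_maskSet hι F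
  have hw : wickTable₃ (D.table ![a, b, c] X) = true :=
    wickTable₃_of_exchange _ _ _ _ _ _ _ _ (hD.1.exchangeTable_table hι hX)
      (hD.exchangeTable_slideTable hι hιE hX (i := 2) (j := 0) (by decide))
      (hD.exchangeTable_slideTable hι hιE hX (i := 0) (j := 1) (by decide))
      (hD.exchangeTable_slideTable hι hιE hX (i := 1) (j := 2) (by decide))
  have hl : (D.table ![a, b, c] X).getD s false = true := by
    classical rwa [getD_table _ _ _ hs, decide_eq_true_iff]
  have hw' := List.all_eq_true.1 hw s (List.mem_range.2 hs)
  rw [hl, Bool.not_true, Bool.false_or, beq_iff_eq] at hw'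
  have h7 : ({a, b, c} : Finset α) = maskSet ![a, b, c] 7 := by
    ext z; simp [mem_maskSet, Fin.exists_fin_succ, Nat.testBit, @eq_comm α z]
  have h1 : ({a} : Finset α) = maskSet ![a, b, c] 1 := by
    ext z; simp [mem_maskSet, Fin.exists_fin_succ, Nat.testBit, @eq_comm α z]
  have h2 : ({b} : Finset α) = maskSet ![a, b, c] 2 := by
    ext z; simp [mem_maskSet, Fin.exists_fin_succ, Nat.testBit, @eq_comm α z]
  have h4 : ({c} : Finset α) = maskSet ![a, b, c] 4 := by
    ext z; simp [mem_maskSet, Fin.exists_fin_succ, Nat.testBit, @eq_comm α z]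
  have h3 : ({a, b} : Finset α) = maskSet ![a, b, c] 3 := by
    ext z; simp [mem_maskSet, Fin.exists_fin_succ, Nat.testBit, @eq_comm α z]
  have h5 : ({a, c} : Finset α) = maskSet ![a, b, c] 5 := by
    ext z; simp [mem_maskSet, Fin.exists_fin_succ, Nat.testBit, @eq_comm α z]
  have h6 : ({b, c} : Finset α) = maskSet ![a, b, c] 6 := by
    ext z; simp [mem_maskSet, Fin.exists_fin_succ, Nat.testBit, @eq_comm α z]
  rw [h7, h6, h5, h3, h4, h2, h1]
  rw [ind_maskSet D hι hX hs (by norm_num), ind_maskSet D hι hX hs (by norm_num),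
    ind_maskSet D hι hX hs (by norm_num), ind_maskSet D hι hX hs (by norm_num),
    ind_maskSet D hι hX hs (by norm_num), ind_maskSet D hι hX hs (by norm_num),
    ind_maskSet D hι hX hs (by norm_num)]
  exact ite_bool_xor_and _ _ _ _ _ _ _ hw'

theorem wickTable₄_of_odd_eq_false {l : List Bool} (hl : l.length = 16) {s : ℕ} (hs : s < 16)
    (hodd : ∀ t ∈ [1, 2, 4, 8, 7, 11, 13, 14], l.getD (s ^^^ t) false = false)
    (h : exchangeTable 4 l = true) (h32 : exchangeTable 4 (slideTable 4 3 2 l) = true)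
    (h20 : exchangeTable 4 (slideTable 4 2 0 l) = true)
    (h30 : exchangeTable 4 (slideTable 4 3 0 l) = true)
    (h01 : exchangeTable 4 (slideTable 4 0 1 l) = true) : wickTable₄ l = true := by
  have heq : l = (List.range 16).map fun i => l.getD i false := by
    apply List.ext_getElem <;> simp +contextual [hl]
  simp only [List.mem_cons, List.not_mem_nil, or_false, forall_eq_or_imp, forall_eq] at hodd
  have hcase : (l.getD 1 false = false ∧ l.getD 2 false = false ∧ l.getD 4 false = false ∧
      l.getD 8 false = false ∧ l.getD 7 false = false ∧ l.getD 11 false = false ∧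
      l.getD 13 false = false ∧ l.getD 14 false = false) ∨
      (l.getD 0 false = false ∧ l.getD 3 false = false ∧ l.getD 5 false = false ∧
      l.getD 6 false = false ∧ l.getD 9 false = false ∧ l.getD 10 false = false ∧
      l.getD 12 false = false ∧ l.getD 15 false = false) := by
    clear heq h h32 h20 h30 h01 hl
    interval_cases s <;> simp only [Nat.reduceXor] at hodd <;> tauto
  rcases hcase with ⟨e1, e2, e3, e4, e5, e6, e7, e8⟩ | ⟨e1, e2, e3, e4, e5, e6, e7, e8⟩
  · refine wickTable₄_of_exchange_even (l.getD 0 false) (l.getD 3 false) (l.getD 5 false)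
      (l.getD 6 false) (l.getD 9 false) (l.getD 10 false) (l.getD 12 false) (l.getD 15 false)
      l (heq.trans ?_) h h32 h20 h30
    simp only [show List.range 16 = [0, 1, 2, 3, 4, 5, 6, 7, 8, 9, 10, 11, 12, 13, 14, 15] from rfl,
      List.map, e1, e2, e3, e4, e5, e6, e7, e8]
  · refine wickTable₄_of_exchange_odd (l.getD 1 false) (l.getD 2 false) (l.getD 4 false)
      (l.getD 7 false) (l.getD 8 false) (l.getD 11 false) (l.getD 13 false) (l.getD 14 false)
      l (heq.trans ?_) h h32 h01
    simp only [show List.range 16 = [0, 1, 2, 3, 4, 5, 6, 7, 8, 9, 10, 11, 12, 13, 14, 15] from rfl,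
      List.map, e1, e2, e3, e4, e5, e6, e7, e8]

theorem IsSlideStable.ind_quadruple {D : SetSystem α} (hD : D.IsSlideStable) {F : Finset α}
    (hF : F ∈ D.F) {a b c d : α} (ha : a ∈ D.E) (hb : b ∈ D.E) (hc : c ∈ D.E) (hd : d ∈ D.E)
    (hab : a ≠ b) (hac : a ≠ c) (had : a ≠ d) (hbc : b ≠ c) (hbd : b ≠ d) (hcd : c ≠ d)
    (ha0 : D.ind F {a} = 0) (hb0 : D.ind F {b} = 0) (hc0 : D.ind F {c} = 0)
    (hd0 : D.ind F {d} = 0) :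
    D.ind F {a, b, c, d} = D.ind F {a, b} * D.ind F {c, d} + D.ind F {a, c} * D.ind F {b, d} +
      D.ind F {a, d} * D.ind F {b, c} := by
  have h_abc : D.ind F {a, b, c} = 0 := by
    rw [hD.ind_triple hF ha hb hc hab hac hbc, ha0, hb0, hc0]; simp
  have h_abd : D.ind F {a, b, d} = 0 := by
    rw [hD.ind_triple hF ha hb hd hab had hbd, ha0, hb0, hd0]; simp
  have h_acd : D.ind F {a, c, d} = 0 := by
    rw [hD.ind_triple hF ha hc hd hac had hcd, ha0, hc0, hd0]; simp
  have h_bcd : D.ind F {b, c, d} = 0 := by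
    rw [hD.ind_triple hF hb hc hd hbc hbd hcd, hb0, hc0, hd0]; simp
  have hι : Function.Injective ![a, b, c, d] := by
    intro i j; fin_cases i <;> fin_cases j <;> simp_all [eq_comm]
  have hιE : ∀ i, ![a, b, c, d] i ∈ D.E := by intro i; fin_cases i <;> simpa
  obtain ⟨X, hX, s, hs, rfl⟩ := exists_eq_union_maskSet hι F
  have hmask (S : Finset α) (t : ℕ) (ht : t < 16) (hS : S = maskSet ![a, b, c, d] t) :
      D.ind (X ∪ maskSet ![a, b, c, d] s) S =
        if (D.table ![a, b, c, d] X).getD (s ^^^ t) false = true then 1 else 0 :=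
    hS ▸ ind_maskSet D hι hX hs ht
  rw [hmask _ 1 (by norm_num)
    (by ext z; simp [mem_maskSet, Fin.exists_fin_succ, Nat.testBit, @eq_comm α z])] at ha0
  rw [hmask _ 2 (by norm_num)
    (by ext z; simp [mem_maskSet, Fin.exists_fin_succ, Nat.testBit, @eq_comm α z])] at hb0
  rw [hmask _ 4 (by norm_num)
    (by ext z; simp [mem_maskSet, Fin.exists_fin_succ, Nat.testBit, @eq_comm α z])] at hc0
  rw [hmask _ 8 (by norm_num)
    (by ext z; simp [mem_maskSet, Fin.exists_fin_succ, Nat.testBit, @eq_comm α z])] at hd0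
  rw [hmask _ 7 (by norm_num)
    (by ext z; simp [mem_maskSet, Fin.exists_fin_succ, Nat.testBit, @eq_comm α z])] at h_abc
  rw [hmask _ 11 (by norm_num)
    (by ext z; simp [mem_maskSet, Fin.exists_fin_succ, Nat.testBit, @eq_comm α z])] at h_abd
  rw [hmask _ 13 (by norm_num)
    (by ext z; simp [mem_maskSet, Fin.exists_fin_succ, Nat.testBit, @eq_comm α z])] at h_acd
  rw [hmask _ 14 (by norm_num)
    (by ext z; simp [mem_maskSet, Fin.exists_fin_succ, Nat.testBit, @eq_comm α z])] at h_bcd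
  rw [hmask {a, b, c, d} 15 (by norm_num)
    (by ext z; simp [mem_maskSet, Fin.exists_fin_succ, Nat.testBit, @eq_comm α z]),
    hmask {a, b} 3 (by norm_num)
    (by ext z; simp [mem_maskSet, Fin.exists_fin_succ, Nat.testBit, @eq_comm α z]),
    hmask {c, d} 12 (by norm_num)
    (by ext z; simp [mem_maskSet, Fin.exists_fin_succ, Nat.testBit, @eq_comm α z]),
    hmask {a, c} 5 (by norm_num)
    (by ext z; simp [mem_maskSet, Fin.exists_fin_succ, Nat.testBit, @eq_comm α z]),
    hmask {b, d} 10 (by norm_num)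
    (by ext z; simp [mem_maskSet, Fin.exists_fin_succ, Nat.testBit, @eq_comm α z]),
    hmask {a, d} 9 (by norm_num)
    (by ext z; simp [mem_maskSet, Fin.exists_fin_succ, Nat.testBit, @eq_comm α z]),
    hmask {b, c} 6 (by norm_num)
    (by ext z; simp [mem_maskSet, Fin.exists_fin_succ, Nat.testBit, @eq_comm α z])]
  have hw : wickTable₄ (D.table ![a, b, c, d] X) = true := by
    refine wickTable₄_of_odd_eq_false (by simp [table]) hs ?_ (hD.1.exchangeTable_table hι hX)
      (hD.exchangeTable_slideTable hι hιE hX (i := 3) (j := 2) (by decide))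
      (hD.exchangeTable_slideTable hι hιE hX (i := 2) (j := 0) (by decide))
      (hD.exchangeTable_slideTable hι hιE hX (i := 3) (j := 0) (by decide))
      (hD.exchangeTable_slideTable hι hιE hX (i := 0) (j := 1) (by decide))
    simp only [ite_eq_right_iff, one_ne_zero, imp_false, Bool.not_eq_true] at *
    simp only [List.mem_cons, List.not_mem_nil, or_false, forall_eq_or_imp, forall_eq]
    exact ⟨ha0, hb0, hc0, hd0, h_abc, h_abd, h_acd, h_bcd⟩
  have hl : (D.table ![a, b, c, d] X).getD s false = true := by
    classical rwa [getD_table _ _ _ hs, decide_eq_true_iff]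
  have hw' := List.all_eq_true.1 hw s (List.mem_range.2 hs)
  rw [hl, Bool.not_true, Bool.false_or, beq_iff_eq] at hw'
  exact ite_bool_xor_and _ _ _ _ _ _ _ hw'

end SetSystem

/-- The determinant of a Schur complement, for principal submatrices indexed by finsets. -/
theorem Matrix.det_submatrix_coe_schur {α m R : Type*} [DecidableEq α] [Fintype m] [DecidableEq m]
    [CommRing R] (A : Matrix α α R) {κ : m → α} (hκ : Function.Injective κ) {W V : Finset α}
    (hW : ∀ x, x ∈ W ↔ (∃ i, κ i = x) ∨ x ∈ V) (hV : ∀ i, κ i ∉ V) (B : Matrix m m R)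
    (hB : A.submatrix κ κ * B = 1) :
    (A.submatrix (Subtype.val : W → α) Subtype.val).det = (A.submatrix κ κ).det *
      (A.submatrix (Subtype.val : V → α) Subtype.val -
        A.submatrix (Subtype.val : V → α) κ * B * A.submatrix κ (Subtype.val : V → α)).det := by
  let e : m ⊕ V → W := Sum.elim (fun i => ⟨κ i, (hW _).2 (Or.inl ⟨i, rfl⟩)⟩)
    (fun x => ⟨x, (hW _).2 (Or.inr x.2)⟩)
  have he : Function.Bijective e := by
    constructor
    · rintro (i | x) (j | y) h
      · exact congrArg _ (hκ (congrArg Subtype.val h))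
      · exact absurd (by rw [show κ i = y from congrArg Subtype.val h]; exact y.2) (hV i)
      · exact absurd (by rw [← show (x : α) = κ j from congrArg Subtype.val h]; exact x.2) (hV j)
      · exact congrArg _ (Subtype.ext (show (x : α) = y from congrArg (Subtype.val : W → α) h))
    · rintro ⟨x, hx⟩
      obtain ⟨i, rfl⟩ | hx' := (hW x).1 hx
      exacts [⟨Sum.inl i, rfl⟩, ⟨Sum.inr ⟨x, hx'⟩, rfl⟩]
  let _ : Invertible (A.submatrix κ κ) := ⟨B, mul_eq_one_comm.1 hB, hB⟩
  rw [← Matrix.det_submatrix_equiv_self (Equiv.ofBijective e he),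
    show B = ⅟(A.submatrix κ κ) from rfl, ← Matrix.det_fromBlocks₁₁]
  congr 1
  ext (i | i) (j | j) <;> rfl

namespace SetSystem

variable {α : Type*} [DecidableEq α]

/-- The matrix over `GF(2)` read off from the feasible sets close to `F`. -/
noncomputable def localMatrix (D : SetSystem α) (F : Finset α) : Matrix α α (ZMod 2) :=
  fun i j => if i = j then D.ind F {i} else D.ind F {i, j} + D.ind F {i} * D.ind F {j}

theorem localMatrix_isSymm (D : SetSystem α) (F : Finset α) : (D.localMatrix F).IsSymm := by
  ext i j
  by_cases h : i = j
  · simp [localMatrix, h]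
  · simp [localMatrix, h, Ne.symm h, Finset.pair_comm, mul_comm]

theorem symmDiff_symmDiff_sdiff {F S W : Finset α} (h : S ⊆ W) :
    symmDiff (symmDiff F S) (W \ S) = symmDiff F W := by
  rw [symmDiff_assoc]
  congr 1
  ext z
  have := @h z
  simp only [Finset.mem_symmDiff, Finset.mem_sdiff]
  tauto

theorem IsSlideStable.localMatrix_symmDiff_singleton {D : SetSystem α} (hD : D.IsSlideStable)
    {F : Finset α} (hF : F ∈ D.F) {i j k : α} (hi : i ∈ D.E) (hj : j ∈ D.E) (hk : k ∈ D.E)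
    (hij : i ≠ j) (hik : i ≠ k) (h : D.ind F {i} = 1) :
    D.localMatrix (symmDiff F {i}) j k =
      D.localMatrix F j k - D.localMatrix F j i * D.localMatrix F i k := by
  have hs (S : Finset α) (hS : i ∉ S) : symmDiff {i} S = insert i S := by
    rw [symmDiff_eq_sup_sdiff_inf]; simp [hS]
  by_cases hjk : j = k
  · subst hjk
    simp only [localMatrix, if_true, if_neg hij, if_neg hij.symm, ind_symmDiff]
    rw [hs _ (by simpa using hij), Finset.pair_comm j i, h]
    generalize D.ind F _ = x
    generalize D.ind F _ = y
    decide +revert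
  · simp only [localMatrix, if_neg hjk, if_neg hij.symm, if_neg hik, ind_symmDiff]
    rw [hs {j, k} (by simp [hij, hik]), hs {j} (by simpa using hij), hs {k} (by simpa using hik),
      hD.ind_triple hF hi hj hk hij hik hjk, Finset.pair_comm j i, h]
    generalize D.ind F _ = x
    generalize D.ind F _ = y
    generalize D.ind F _ = z
    generalize D.ind F _ = w
    generalize D.ind F _ = v
    decide +revert

theorem IsSlideStable.localMatrix_symmDiff_pair {D : SetSystem α} (hD : D.IsSlideStable)
    {F : Finset α} (hF : F ∈ D.F) {i j k l : α} (hi : i ∈ D.E) (hj : j ∈ D.E) (hk : k ∈ D.E)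
    (hl : l ∈ D.E) (hij : i ≠ j) (hik : i ≠ k) (hil : i ≠ l) (hjk : j ≠ k) (hjl : j ≠ l)
    (hi0 : D.ind F {i} = 0) (hj0 : D.ind F {j} = 0) (hk0 : D.ind F {k} = 0)
    (hl0 : D.ind F {l} = 0) (h : D.ind F {i, j} = 1) :
    D.localMatrix (symmDiff F {i, j}) k l = D.localMatrix F k l -
      (D.localMatrix F k i * D.localMatrix F j l + D.localMatrix F k j * D.localMatrix F i l) := by
  have hs (S : Finset α) (hi : i ∉ S) (hj : j ∉ S) :
      symmDiff {i, j} S = insert i (insert j S) := by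
    rw [Disjoint.symmDiff_eq_sup (by simp [hi, hj])]; simp
  by_cases hkl : k = l
  · subst hkl
    simp only [localMatrix, if_true, if_neg hik, if_neg hjk, if_neg hik.symm, if_neg hjk.symm,
      ind_symmDiff]
    rw [hs _ (by simpa using hik) (by simpa using hjk), hD.ind_triple hF hi hj hk hij hik hjk,
      Finset.pair_comm k i, Finset.pair_comm k j, hi0, hj0, hk0, h]
    clear hi0 hj0 hk0 h
    generalize D.ind F _ = x
    generalize D.ind F _ = y
    decide +revert
  · simp only [localMatrix, if_neg hkl, if_neg hik.symm, if_neg hjk.symm, if_neg hil, if_neg hjl,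
      ind_symmDiff]
    rw [hs {k, l} (by simp [hik, hil]) (by simp [hjk, hjl]), hs {k} (by simpa using hik)
      (by simpa using hjk), hs {l} (by simpa using hil) (by simpa using hjl),
      hD.ind_triple hF hi hj hk hij hik hjk, hD.ind_triple hF hi hj hl hij hil hjl,
      hD.ind_quadruple hF hi hj hk hl hij hik hil hjk hjl hkl hi0 hj0 hk0 hl0,
      Finset.pair_comm k i, Finset.pair_comm k j, hi0, hj0, hk0, hl0, h]
    clear hi0 hj0 hk0 hl0 h
    generalize D.ind F _ = x
    generalize D.ind F _ = y
    generalize D.ind F _ = z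
    generalize D.ind F _ = w
    generalize D.ind F _ = v
    decide +revert

theorem IsSlideStable.ind_eq_det {D : SetSystem α} (hD : D.IsSlideStable) {F W : Finset α}
    (hF : F ∈ D.F) (hW : W ⊆ D.E) :
    D.ind F W = ((D.localMatrix F).submatrix (Subtype.val : W → α) Subtype.val).det := by
  induction hn : W.card using Nat.strong_induction_on generalizing F W with
  | _ n ih =>
  have hsub {S : Finset α} (hS : S ⊆ W) (hne : S.Nonempty) (hFS : symmDiff F S ∈ D.F) :
      D.ind F W = ((D.localMatrix (symmDiff F S)).submatrix
        (Subtype.val : (W \ S : Finset α) → α) Subtype.val).det := by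
    rw [← ih _ (hn ▸ Finset.card_lt_card (Finset.sdiff_ssubset hS hne)) hFS
      (Finset.sdiff_subset.trans hW) rfl, ind, ind, symmDiff_symmDiff_sdiff hS]
  by_cases h1 : ∃ i ∈ W, symmDiff F {i} ∈ D.F
  · obtain ⟨i, hi, hFi⟩ := h1
    have hone : D.ind F {i} = 1 := ind_eq_one hFi
    have hA : (D.localMatrix F).submatrix (fun _ : Unit => i) (fun _ : Unit => i) = 1 := by
      ext; simp [localMatrix, hone]
    rw [hsub (by simpa using hi) (by simp) hFi,
      Matrix.det_submatrix_coe_schur (D.localMatrix F) (κ := fun _ : Unit => i) (V := W \ {i})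
      (fun _ _ _ => rfl) (fun x => by by_cases hx : x = i <;> simp [hx, hi, @eq_comm α i])
      (by simp) 1 (by rw [hA, one_mul]), hA, Matrix.det_one, one_mul, Matrix.mul_one]
    congr 1
    ext ⟨x, hx⟩ ⟨y, hy⟩
    rw [Finset.mem_sdiff, Finset.mem_singleton] at hx hy
    simpa [Matrix.mul_apply] using hD.localMatrix_symmDiff_singleton hF (hW hi) (hW hx.1)
      (hW hy.1) (Ne.symm hx.2) (Ne.symm hy.2) hone
  push Not at h1
  have hz {i : α} (hi : i ∈ W) : D.ind F {i} = 0 := ind_eq_zero (h1 i hi)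
  by_cases h2 : ∃ i ∈ W, ∃ j ∈ W, i ≠ j ∧ symmDiff F {i, j} ∈ D.F
  · obtain ⟨i, hi, j, hj, hij, hFij⟩ := h2
    have hone : D.ind F {i, j} = 1 := ind_eq_one hFij
    have hA : (D.localMatrix F).submatrix ![i, j] ![i, j] = !![0, 1; 1, 0] := by
      ext k l
      fin_cases k <;> fin_cases l <;>
        simp [localMatrix, hz hi, hz hj, hij, hij.symm, Finset.pair_comm j i, hone]
    have hsq : (!![0, 1; 1, 0] : Matrix (Fin 2) (Fin 2) (ZMod 2)) * !![0, 1; 1, 0] = 1 := by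
      decide
    have hdet : (!![0, 1; 1, 0] : Matrix (Fin 2) (Fin 2) (ZMod 2)).det = 1 := by decide
    have hSW : {i, j} ⊆ W := by simp [Finset.insert_subset_iff, hi, hj]
    rw [hsub hSW (by simp) hFij,
      Matrix.det_submatrix_coe_schur (D.localMatrix F) (κ := ![i, j]) (V := W \ {i, j})
      (by intro k l; fin_cases k <;> fin_cases l <;> simp [hij, hij.symm])
      (fun x => by
        by_cases hx : x = i <;> by_cases hx' : x = j <;>
          simp [Fin.exists_fin_two, hx, hx', hi, hj, @eq_comm α _ x])
      (by simp [Fin.forall_fin_two]) !![0, 1; 1, 0] (by rw [hA, hsq]), hA, hdet, one_mul]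
    congr 1
    ext ⟨x, hx⟩ ⟨y, hy⟩
    simp only [Finset.mem_sdiff, Finset.mem_insert, Finset.mem_singleton, not_or] at hx hy
    simp only [Matrix.sub_apply, Matrix.mul_apply, Fin.sum_univ_two, Matrix.submatrix_apply]
    simpa [add_comm] using
      hD.localMatrix_symmDiff_pair hF (hW hi) (hW hj) (hW hx.1) (hW hy.1) hij (Ne.symm hx.2.1)
      (Ne.symm hy.2.1) (Ne.symm hx.2.2) (Ne.symm hy.2.2) (hz hi) (hz hj) (hz hx.1) (hz hy.1) hone
  push Not at h2
  have hzero : (D.localMatrix F).submatrix (Subtype.val : W → α) (Subtype.val : W → α) = 0 := by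
    ext ⟨x, hx⟩ ⟨y, hy⟩
    by_cases hxy : x = y
    · simp [localMatrix, hxy, hz hy]
    · simp [localMatrix, hxy, hz hx, ind_eq_zero (h2 x hx y hy hxy)]
  rw [hzero]
  obtain rfl | ⟨x, hx⟩ := W.eq_empty_or_nonempty
  · rw [Matrix.det_isEmpty, ind_eq_one]
    rwa [← Finset.bot_eq_empty, symmDiff_bot]
  · have : Nonempty W := ⟨⟨x, hx⟩⟩
    rw [Matrix.det_zero]
    refine ind_eq_zero fun hFW => ?_
    have hs : symmDiff F (symmDiff F W) = W := symmDiff_symmDiff_cancel_left F W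
    obtain ⟨y, hy, hxy⟩ := hD.1.2.2 F hF _ hFW x (by rwa [hs])
    rw [hs] at hy
    by_cases h : x = y
    · exact h1 x hx (by simpa [← h] using hxy)
    · exact h2 x hx y hy h hxy

theorem IsSlideStable.isBinary {D : SetSystem α} (hD : D.IsSlideStable) : D.IsBinary := by
  obtain ⟨F, hF⟩ := hD.1.1
  refine ⟨F, hF, (D.localMatrix F).submatrix Subtype.val Subtype.val,
    (D.localMatrix_isSymm F).submatrix _, ?_⟩
  have hsub := hD.1.2.1
  have key (X : Finset α) (hX : X ⊆ D.E) : symmDiff F X ∈ D.F ↔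
      IsUnit ((D.localMatrix F).submatrix (Subtype.val : X → α) (Subtype.val : X → α)) := by
    rw [← ind_ne_zero_iff, hD.ind_eq_det hF hX, Matrix.isUnit_iff_isUnit_det, isUnit_iff_ne_zero]
  have hFeq : D.F =
      ((ofMatrix D.E ((D.localMatrix F).submatrix Subtype.val Subtype.val)).twist F).F := by
    ext Y
    constructor
    · intro hY
      have hX : symmDiff F Y ⊆ D.E :=
        symmDiff_le_sup.trans (Finset.union_subset (hsub F hF) (hsub Y hY))
      refine ⟨symmDiff F Y, ⟨hX, ?_⟩, (symmDiff_symmDiff_cancel_left F Y).symm⟩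
      exact (key _ hX).1 (by rwa [symmDiff_symmDiff_cancel_left])
    · rintro ⟨X, ⟨hX, hu⟩, rfl⟩
      exact (key X hX).2 hu
  exact congrArg (SetSystem.mk D.E) hFeq

end SetSystem

/-- A non-binary delta-matroid admits a (nonempty) sequence of handle
slides producing a set system that is not a delta-matroid; hence the only class of
delta-matroids closed under handle slides is the class of binary delta-matroids. -/
theorem stmt_0 {α : Type*} [DecidableEq α] (D : SetSystem α)
    (hD : D.IsDeltaMatroid) (hnb : ¬ D.IsBinary) :
    ∃ L : List (α × α), L ≠ [] ∧
      (∀ p ∈ L, p.1 ∈ D.E ∧ p.2 ∈ D.E ∧ p.1 ≠ p.2) ∧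
      ¬ (D.slides L).IsDeltaMatroid := by
  by_contra h
  refine hnb (IsSlideStable.isBinary ⟨hD, fun a ha b hb hab => ?_⟩)
  by_contra hslide
  exact h ⟨[(a, b)], by simp, by simp [ha, hb, hab], hslide⟩
end

section
/- Let D = (E, 𝓕) be a set system, let a, b ∈ E with a ≠ b, and let e ∈ E − {a, b}. Then contraction commutes with the handle slide: D_{ab}/e = (D/e)_{ab}, i.e., the feasible sets satisfy 𝓕_{ab}/e = (𝓕/e)_{ab}, where 𝓕/e = {F : F ⊆ E − e, F ∪ {e} ∈ 𝓕}. -/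
open SetSystem

/-- A set `Y` avoiding `e` is added or removed by the handle slide of `D / e` exactly when
`Y ∪ {e}` is added or removed by the handle slide of `D`. -/
theorem SetSystem.exists_slide_union_singleton_iff {α : Type*} [DecidableEq α] (D : SetSystem α)
    {a b e : α} (hb : b ∈ D.E) (he : e ∈ D.E) (hea : e ≠ a) (heb : e ≠ b)
    {Y : Finset α} (hY : Y ⊆ D.E.erase e) :
    (∃ X : Finset α, X ⊆ D.E \ {a, b} ∧ X ∪ {b} ∈ D.F ∧ Y ∪ {e} = X ∪ {a}) ↔
      ∃ X : Finset α, X ⊆ (D.contr e).E \ {a, b} ∧ X ∪ {b} ∈ (D.contr e).F ∧ Y = X ∪ {a} := by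
  have heY : e ∉ Y := fun h => (Finset.mem_erase.mp (hY h)).1 rfl
  constructor
  · rintro ⟨X, hX, hXF, hXY⟩
    have heX : e ∈ X := by
      have : e ∈ X ∪ {a} := hXY ▸ (by simp)
      simpa [hea] using this
    refine ⟨X.erase e, ?_, ⟨?_, ?_⟩, ?_⟩
    · intro x hx
      have := @hX x
      simp only [contr, Finset.mem_sdiff, Finset.mem_erase] at this hx ⊢
      tauto
    · intro x hx
      have := @hX x
      simp only [Finset.mem_sdiff, Finset.mem_erase, Finset.mem_union,
        Finset.mem_singleton] at this hx ⊢
      grind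
    · convert hXF using 1
      grind
    · ext x
      have := Finset.ext_iff.mp hXY x
      grind
  · rintro ⟨X, hX, ⟨-, hXF⟩, rfl⟩
    refine ⟨X ∪ {e}, ?_, ?_, Finset.union_right_comm _ _ _⟩
    · intro x hx
      have := @hX x
      simp only [contr, Finset.mem_sdiff, Finset.mem_erase, Finset.mem_union,
        Finset.mem_singleton, Finset.mem_insert] at this hx ⊢
      grind
    · rwa [Finset.union_right_comm]

/-- contraction commutes with the handle slide:
`D_{ab}/e = (D/e)_{ab}` for `e ∈ E − {a, b}`. -/
theorem stmt_3 {α : Type*} [DecidableEq α] (D : SetSystem α)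
    (a b e : α) (ha : a ∈ D.E) (hb : b ∈ D.E) (hab : a ≠ b)
    (he : e ∈ D.E) (hea : e ≠ a) (heb : e ≠ b) :
    (D.slide a b).contr e = (D.contr e).slide a b := by
  refine congrArg (SetSystem.mk (D.E.erase e)) (Set.ext fun Y => ?_)
  by_cases hY : Y ⊆ D.E.erase e
  · have key := D.exists_slide_union_singleton_iff (a := a) hb he hea heb hY
    have hF : Y ∈ (D.contr e).F ↔ Y ∪ {e} ∈ D.F := and_iff_right hY
    simp only [slide, Set.mem_ofPred_eq, Set.mem_symmDiff, key, hF, hY, true_and]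
  · refine iff_of_false (fun h => hY h.1) ?_
    rintro (⟨h, -⟩ | ⟨⟨X, -, ⟨hX, -⟩, rfl⟩, -⟩)
    · exact hY h.1
    · refine hY (Finset.union_subset (Finset.subset_union_left.trans hX) ?_)
      simp [ha, hea.symm]
end

section
/- Let D = (E, 𝓕) be a set system, A ⊆ E, and a, b ∈ E with a ≠ b and a, b ∉ A. Then the handle slide commutes with the twist: (D⋆A)_{ab} = D_{ab}⋆A. -/
open SetSystem

namespace SetSystem

variable {α : Type*} [DecidableEq α]

theorem mem_twist_iff (D : SetSystem α) (A Y : Finset α) :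
    Y ∈ (D.twist A).F ↔ symmDiff A Y ∈ D.F := by
  constructor
  · rintro ⟨X, hX, rfl⟩
    rwa [symmDiff_symmDiff_cancel_left]
  · exact fun h => ⟨_, h, (symmDiff_symmDiff_cancel_left A Y).symm⟩

theorem symmDiff_union_singleton {A : Finset α} {c : α} (hc : c ∉ A) (X : Finset α) :
    symmDiff A (X ∪ {c}) = symmDiff A X ∪ {c} := by
  ext x
  by_cases hx : x = c
  · subst hx
    simp [Finset.mem_symmDiff, hc]
  · simp [Finset.mem_symmDiff, hx]

theorem symmDiff_subset_sdiff_pair {E A X : Finset α} {a b : α} (hA : A ⊆ E)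
    (haA : a ∉ A) (hbA : b ∉ A) (hX : X ⊆ E \ {a, b}) : symmDiff A X ⊆ E \ {a, b} := by
  refine symmDiff_le_sup.trans (Finset.union_subset ?_ hX)
  rw [Finset.subset_sdiff]
  exact ⟨hA, by simp [haA, hbA]⟩

/-- The collection added by a handle slide is twisted along with the feasible sets. -/
theorem slide_twist_correction_iff (D : SetSystem α) {A : Finset α} (hA : A ⊆ D.E)
    {a b : α} (haA : a ∉ A) (hbA : b ∉ A) (Y : Finset α) :
    (∃ X ⊆ D.E \ {a, b}, X ∪ {b} ∈ (D.twist A).F ∧ Y = X ∪ {a}) ↔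
      ∃ X ⊆ D.E \ {a, b}, X ∪ {b} ∈ D.F ∧ symmDiff A Y = X ∪ {a} := by
  constructor
  · rintro ⟨X, hX, hXb, rfl⟩
    rw [mem_twist_iff, symmDiff_union_singleton hbA] at hXb
    exact ⟨_, symmDiff_subset_sdiff_pair hA haA hbA hX, hXb, symmDiff_union_singleton haA X⟩
  · rintro ⟨X, hX, hXb, hY⟩
    refine ⟨_, symmDiff_subset_sdiff_pair hA haA hbA hX, ?_, ?_⟩
    · rwa [mem_twist_iff, symmDiff_union_singleton hbA, symmDiff_symmDiff_cancel_left]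
    · rw [← symmDiff_union_singleton haA, ← hY, symmDiff_symmDiff_cancel_left]

end SetSystem

/-- the handle slide commutes with twisting by a set avoiding `a, b`:
`(D⋆A)_{ab} = D_{ab}⋆A`. -/
theorem stmt_5 {α : Type*} [DecidableEq α] (D : SetSystem α)
    (A : Finset α) (hA : A ⊆ D.E)
    (a b : α) (ha : a ∈ D.E) (hb : b ∈ D.E) (hab : a ≠ b)
    (haA : a ∉ A) (hbA : b ∉ A) :
    (D.twist A).slide a b = (D.slide a b).twist A := by
  have h : ((D.twist A).slide a b).F = ((D.slide a b).twist A).F := by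
    ext Y
    rw [mem_twist_iff]
    exact or_congr
      (and_congr (mem_twist_iff D A Y) (not_congr (slide_twist_correction_iff D hA haA hbA Y)))
      (and_congr (slide_twist_correction_iff D hA haA hbA Y) (not_congr (mem_twist_iff D A Y)))
  exact congrArg (SetSystem.mk D.E) h
end

section
/- Let D = (E, 𝓕) be a set system, A ⊆ E, and a, b ∈ E with a ≠ b and a, b ∈ A. Then (D⋆A)_{ba} = D_{ab}⋆A, i.e., sliding b over a in the twist D⋆A yields the twist by A of the handle slide of D taking a over b. -/
open SetSystem

namespace SetSystem

variable {α : Type*} [DecidableEq α]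

theorem mem_twist_F {D : SetSystem α} {A Y : Finset α} :
    Y ∈ (D.twist A).F ↔ symmDiff A Y ∈ D.F := by
  constructor
  · rintro ⟨X, hX, rfl⟩
    rwa [symmDiff_symmDiff_cancel_left]
  · intro h
    exact ⟨_, h, (symmDiff_symmDiff_cancel_left A Y).symm⟩

theorem exists_slide_iff {D : SetSystem α} {a b : α} (ha : a ∈ D.E) (hab : a ≠ b)
    {Y : Finset α} :
    (∃ X : Finset α, X ⊆ D.E \ {a, b} ∧ X ∪ {b} ∈ D.F ∧ Y = X ∪ {a}) ↔
      Y ⊆ D.E ∧ a ∈ Y ∧ b ∉ Y ∧ symmDiff Y {a, b} ∈ D.F := by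
  constructor
  · rintro ⟨X, hX, hF, rfl⟩
    have haX : a ∉ X := fun h => by simpa using hX h
    have hbX : b ∉ X := fun h => by simpa using hX h
    refine ⟨Finset.union_subset (hX.trans Finset.sdiff_subset) (by simpa), by simp,
      by simp [hbX, hab.symm], ?_⟩
    convert hF using 1
    ext x
    simp only [Finset.mem_symmDiff, Finset.mem_union, Finset.mem_insert, Finset.mem_singleton]
    grind
  · rintro ⟨hY, haY, hbY, hF⟩
    refine ⟨Y.erase a, by grind, ?_, by grind⟩
    convert hF using 1
    ext x
    simp only [Finset.mem_symmDiff, Finset.mem_union, Finset.mem_erase, Finset.mem_insert,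
      Finset.mem_singleton]
    grind

theorem mem_slide_F {D : SetSystem α} {a b : α} (ha : a ∈ D.E) (hab : a ≠ b) {Y : Finset α} :
    Y ∈ (D.slide a b).F ↔
      Xor (Y ∈ D.F) (Y ⊆ D.E ∧ a ∈ Y ∧ b ∉ Y ∧ symmDiff Y {a, b} ∈ D.F) := by
  rw [← exists_slide_iff ha hab]
  rfl

theorem symmDiff_subset_iff_of_subset {A E Y : Finset α} (hA : A ⊆ E) :
    symmDiff A Y ⊆ E ↔ Y ⊆ E := by
  simp only [Finset.subset_iff, Finset.mem_symmDiff] at *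
  grind

end SetSystem

/-- for `a, b ∈ A`, sliding `b` over `a` in the twist `D⋆A` is the
twist by `A` of the handle slide of `D` taking `a` over `b`:
`(D⋆A)_{ba} = D_{ab}⋆A`. -/
theorem stmt_6 {α : Type*} [DecidableEq α] (D : SetSystem α)
    (A : Finset α) (hA : A ⊆ D.E)
    (a b : α) (ha : a ∈ D.E) (hb : b ∈ D.E) (hab : a ≠ b)
    (haA : a ∈ A) (hbA : b ∈ A) :
    (D.twist A).slide b a = (D.slide a b).twist A := by
  have hF : ((D.twist A).slide b a).F = ((D.slide a b).twist A).F := by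
    ext Y
    have haY : a ∈ symmDiff A Y ↔ a ∉ Y := by simp [Finset.mem_symmDiff, haA]
    have hbY : b ∉ symmDiff A Y ↔ b ∈ Y := by simp [Finset.mem_symmDiff, hbA]
    rw [mem_twist_F, mem_slide_F ha hab, mem_slide_F (D := D.twist A) hb hab.symm,
      mem_twist_F, mem_twist_F, symmDiff_subset_iff_of_subset hA, haY, hbY,
      Finset.pair_comm b a, symmDiff_assoc, and_left_comm (a := a ∉ Y)]
    rfl
  exact congrArg (SetSystem.mk D.E) hF
end

section
/- Let S₁ be the delta-matroid ({1,2,3}, {∅, {1,2}, {1,3}, {2,3}, {1,2,3}}). Then the handle slide (S₁)₁₂ equals the set system ({1,2,3}, {∅, {1,2}, {2,3}, {1,2,3}}), and this set system is not a delta-matroid (the symmetric exchange axiom fails). -/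
open SetSystem

/-- The sets toggled when sliding `1` over `2` in `S₁`. -/
theorem S₁_slide_family :
    {Y : Finset ℕ | ∃ X : Finset ℕ, X ⊆ S₁.E \ {1, 2} ∧ X ∪ {2} ∈ S₁.F ∧ Y = X ∪ {1}} =
      {{1, 3}} := by
  have hE : S₁.E \ {1, 2} = {3} := by decide
  ext Y
  simp only [hE, Finset.subset_singleton_iff, Set.mem_ofPred_eq, Set.mem_singleton_iff]
  constructor
  · rintro ⟨X, rfl | rfl, hX, rfl⟩
    · simp only [S₁, Set.mem_insert_iff, Set.mem_singleton_iff] at hX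
      exact absurd hX (by decide)
    · decide
  · rintro rfl
    refine ⟨{3}, Or.inr rfl, ?_, by decide⟩
    simp only [S₁, Set.mem_insert_iff, Set.mem_singleton_iff]
    decide

/-- `(S₁)₁₂ = ({1,2,3}, {∅, {1,2}, {2,3}, {1,2,3}})`, which is not a
delta-matroid. -/
theorem stmt_7 :
    S₁.slide 1 2 = (⟨{1, 2, 3}, {∅, {1, 2}, {2, 3}, {1, 2, 3}}⟩ : SetSystem ℕ) ∧
    ¬ (⟨{1, 2, 3}, {∅, {1, 2}, {2, 3}, {1, 2, 3}}⟩ : SetSystem ℕ).IsDeltaMatroid := by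
  constructor
  · rw [slide, S₁_slide_family]
    simp only [S₁, SetSystem.mk.injEq, true_and]
    ext Y
    simp only [Set.mem_symmDiff, Set.mem_insert_iff, Set.mem_singleton_iff]
    constructor
    · rintro (⟨rfl | rfl | rfl | rfl | rfl, h⟩ | ⟨rfl, h⟩)
      all_goals revert h; decide
    · rintro (rfl | rfl | rfl | rfl) <;> decide
  · rintro ⟨-, -, exchange⟩
    obtain ⟨y, hy, hF⟩ := exchange {1, 2, 3} (by simp) ∅ (by simp) 2 (by decide)
    have hy' : y = 1 ∨ y = 2 ∨ y = 3 := by simpa [Finset.mem_symmDiff] using hy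
    simp only [Set.mem_insert_iff, Set.mem_singleton_iff] at hF
    rcases hy' with rfl | rfl | rfl <;> exact absurd hF (by decide)
end

section
/- Let S₃ be the delta-matroid ({1,2,3}, {∅, {2}, {3}, {1,2}, {1,3}, {1,2,3}}). Then the handle slide (S₃)₂₃ equals the set system ({1,2,3}, {∅, {3}, {1,3}, {1,2,3}}), and this set system is not a delta-matroid (the symmetric exchange axiom fails). -/
open SetSystem

/-- The sets added or removed when `2` is slid over `3` in `S₃`. -/
theorem slide_sets_S₃ :
    {Y : Finset ℕ | ∃ X : Finset ℕ, X ⊆ S₃.E \ {2, 3} ∧ X ∪ {3} ∈ S₃.F ∧ Y = X ∪ {2}} =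
      {{2}, {1, 2}} := by
  ext Y
  simp only [Set.mem_ofPred_eq, Set.mem_insert_iff, Set.mem_singleton_iff]
  constructor
  · rintro ⟨X, hX, -, rfl⟩
    have hX' : X ⊆ {1} := hX.trans (by decide)
    rcases Finset.subset_singleton_iff.mp hX' with rfl | rfl
    · exact Or.inl (by decide)
    · exact Or.inr (by decide)
  · rintro (rfl | rfl)
    · refine ⟨∅, Finset.empty_subset _, ?_, by decide⟩
      simp [S₃]
    · refine ⟨{1}, by decide, ?_, by decide⟩
      change ({1, 3} : Finset ℕ) ∈ S₃.F
      simp [S₃]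

/-- `(S₃)₂₃ = ({1,2,3}, {∅, {3}, {1,3}, {1,2,3}})`, which is not a
delta-matroid. -/
theorem stmt_9 :
    S₃.slide 2 3 = (⟨{1, 2, 3}, {∅, {3}, {1, 3}, {1, 2, 3}}⟩ : SetSystem ℕ) ∧
    ¬ (⟨{1, 2, 3}, {∅, {3}, {1, 3}, {1, 2, 3}}⟩ : SetSystem ℕ).IsDeltaMatroid := by
  refine ⟨?_, ?_⟩
  · unfold SetSystem.slide
    rw [slide_sets_S₃]
    simp only [S₃, SetSystem.mk.injEq, true_and]
    ext Y
    simp only [Set.mem_symmDiff, Set.mem_insert_iff, Set.mem_singleton_iff]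
    constructor
    · tauto
    · rintro (rfl | rfl | rfl | rfl) <;> decide
  · rintro ⟨-, -, h⟩
    obtain ⟨y, hy, hF⟩ := h ∅ (by simp) {1, 2, 3} (by simp) 2 (by decide)
    have hy' : y = 1 ∨ y = 2 ∨ y = 3 := by simpa [Finset.mem_symmDiff] using hy
    simp only [Set.mem_insert_iff, Set.mem_singleton_iff] at hF
    rcases hy' with rfl | rfl | rfl <;> revert hF <;> decide
end

section
/- Let S₄ be the delta-matroid ({1,2,3,4}, {∅, {1,2}, {1,3}, {1,4}, {2,3}, {2,4}, {3,4}}). Then the handle slide (S₄)₁₂ equals the set system ({1,2,3,4}, {∅, {1,2}, {2,3}, {2,4}, {3,4}}), and this set system is not a delta-matroid (the symmetric exchange axiom fails). -/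
open SetSystem

/-- `(S₄)₁₂ = ({1,2,3,4}, {∅, {1,2}, {2,3}, {2,4}, {3,4}})`, which is
not a delta-matroid. -/
theorem stmt_10 :
    S₄.slide 1 2 = (⟨{1, 2, 3, 4}, {∅, {1, 2}, {2, 3}, {2, 4}, {3, 4}}⟩ : SetSystem ℕ) ∧
    ¬ (⟨{1, 2, 3, 4}, {∅, {1, 2}, {2, 3}, {2, 4}, {3, 4}}⟩ : SetSystem ℕ).IsDeltaMatroid := by
  constructor
  · have h : {Y : Finset ℕ | ∃ X : Finset ℕ, X ⊆ ({1, 2, 3, 4} : Finset ℕ) \ {1, 2} ∧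
        X ∪ {2} ∈ S₄.F ∧ Y = X ∪ {1}} = {{1, 3}, {1, 4}} := by
      ext Y
      simp only [S₄, Set.mem_ofPred_eq, Set.mem_insert_iff, Set.mem_singleton_iff]
      constructor
      · rintro ⟨X, hX, hF, rfl⟩
        rw [← Finset.mem_powerset] at hX
        revert X
        decide
      · rintro (rfl | rfl)
        · exact ⟨{3}, by decide, by decide, by decide⟩
        · exact ⟨{4}, by decide, by decide, by decide⟩
    change SetSystem.mk _ (symmDiff S₄.F {Y : Finset ℕ | ∃ X : Finset ℕ,
      X ⊆ ({1, 2, 3, 4} : Finset ℕ) \ {1, 2} ∧ X ∪ {2} ∈ S₄.F ∧ Y = X ∪ {1}}) = _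
    rw [h]
    congr 1
    ext Y
    simp only [S₄, Set.mem_symmDiff, Set.mem_insert_iff, Set.mem_singleton_iff]
    constructor
    · rintro (⟨h₁, h₂⟩ | ⟨h₁, h₂⟩) <;> tauto
    · rintro (rfl | rfl | rfl | rfl | rfl) <;> decide
  · rintro ⟨-, -, h⟩
    have h' := h {3, 4} (by simp) {1, 2} (by simp) 1 (by decide)
    simp only [Set.mem_insert_iff, Set.mem_singleton_iff] at h'
    revert h'
    decide
end

section
/- Let S₅ be the delta-matroid ({1,2,3,4}, {∅, {1,2}, {1,4}, {2,3}, {3,4}, {1,2,3,4}}). Then the handle slide (S₅)₁₃ equals the set system ({1,2,3,4}, {∅, {2,3}, {3,4}, {1,2,3,4}}), and this set system is not a delta-matroid (the symmetric exchange axiom fails). -/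
open SetSystem

/-- The sets toggled by the handle slide of `S₅` taking `1` over `3`. -/
theorem slide_toggled_S₅ :
    {Y : Finset ℕ | ∃ X : Finset ℕ, X ⊆ S₅.E \ {1, 3} ∧ X ∪ {3} ∈ S₅.F ∧ Y = X ∪ {1}} =
      {{1, 2}, {1, 4}} := by
  have key : ∀ X ∈ (({1, 2, 3, 4} : Finset ℕ) \ {1, 3}).powerset,
      (X ∪ {3} = ∅ ∨ X ∪ {3} = {1, 2} ∨ X ∪ {3} = {1, 4} ∨ X ∪ {3} = {2, 3} ∨
        X ∪ {3} = {3, 4} ∨ X ∪ {3} = {1, 2, 3, 4}) →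
      X ∪ {1} = {1, 2} ∨ X ∪ {1} = {1, 4} := by decide
  ext Y
  constructor
  · rintro ⟨X, hX, hF, rfl⟩
    exact key X (Finset.mem_powerset.mpr hX) hF
  · rintro (rfl | rfl)
    · exact ⟨{2}, by decide, Or.inr (Or.inr (Or.inr (Or.inl (by decide)))), by decide⟩
    · exact ⟨{4}, by decide,
        Or.inr (Or.inr (Or.inr (Or.inr (Or.inl (by decide))))), by decide⟩

/-- `(S₅)₁₃ = ({1,2,3,4}, {∅, {2,3}, {3,4}, {1,2,3,4}})`, which is
not a delta-matroid. -/
theorem stmt_11 :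
    S₅.slide 1 3 = (⟨{1, 2, 3, 4}, {∅, {2, 3}, {3, 4}, {1, 2, 3, 4}}⟩ : SetSystem ℕ) ∧
    ¬ (⟨{1, 2, 3, 4}, {∅, {2, 3}, {3, 4}, {1, 2, 3, 4}}⟩ : SetSystem ℕ).IsDeltaMatroid := by
  constructor
  · unfold slide
    rw [slide_toggled_S₅]
    refine congrArg (SetSystem.mk _) ?_
    have h₀ : (∅ : Finset ℕ) ≠ {1, 2} ∧ (∅ : Finset ℕ) ≠ {1, 4} := by decide
    have h₁ : ({2, 3} : Finset ℕ) ≠ {1, 2} ∧ ({2, 3} : Finset ℕ) ≠ {1, 4} := by decide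
    have h₂ : ({3, 4} : Finset ℕ) ≠ {1, 2} ∧ ({3, 4} : Finset ℕ) ≠ {1, 4} := by decide
    have h₃ : ({1, 2, 3, 4} : Finset ℕ) ≠ {1, 2} ∧ ({1, 2, 3, 4} : Finset ℕ) ≠ {1, 4} := by
      decide
    ext Y
    simp only [S₅, Set.mem_symmDiff, Set.mem_insert_iff, Set.mem_singleton_iff]
    grind
  · rintro ⟨-, -, exchange⟩
    have key : ∀ y ∈ symmDiff (∅ : Finset ℕ) {1, 2, 3, 4},
        ¬ (symmDiff (∅ : Finset ℕ) {1, y} = ∅ ∨ symmDiff (∅ : Finset ℕ) {1, y} = {2, 3} ∨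
          symmDiff (∅ : Finset ℕ) {1, y} = {3, 4} ∨
          symmDiff (∅ : Finset ℕ) {1, y} = {1, 2, 3, 4}) := by decide
    obtain ⟨y, hy, hF⟩ := exchange ∅ (Or.inl rfl) {1, 2, 3, 4}
      (Or.inr (Or.inr (Or.inr rfl))) 1 (by decide)
    exact key y hy hF
end

section
/- If D is a binary delta-matroid and e is an element of its ground set, then every elementary minor of D at e (the deletion D − e and the contraction D/e, whenever their collections of feasible sets are nonempty) is also a binary delta-matroid. -/
open SetSystem

namespace SetSystem

variable {α : Type*} [DecidableEq α]

/-- A principal submatrix is invertible iff no nonzero vector supported on its index set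
is mapped to a vector vanishing on that index set. -/
theorem mem_ofMatrix_F_iff {E : Finset α} {A : Matrix E E (ZMod 2)} {W : Finset α} :
    W ∈ (ofMatrix E A).F ↔ W ⊆ E ∧ ∀ v : E → ZMod 2, (∀ i : E, i.1 ∉ W → v i = 0) →
      (∀ i : E, i.1 ∈ W → A.mulVec v i = 0) → v = 0 := by
  have key : ∀ h : (∀ x ∈ W, x ∈ E), ∀ v : E → ZMod 2, (∀ i : E, i.1 ∉ W → v i = 0) →
      ∀ i : W, (Matrix.submatrix A (fun i : W => (⟨i.1, h i.1 i.2⟩ : E))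
        (fun i : W => (⟨i.1, h i.1 i.2⟩ : E))).mulVec (fun i : W => v ⟨i.1, h i.1 i.2⟩) i =
      A.mulVec v ⟨i.1, h i.1 i.2⟩ := by
    intro h v hv i
    simp only [Matrix.mulVec, dotProduct, Matrix.submatrix_apply]
    refine Finset.sum_of_injOn (fun i : W => (⟨i.1, h i.1 i.2⟩ : E)) ?_ ?_ ?_ ?_
    · intro a _ b _ hab
      exact Subtype.ext (congrArg (fun z : E => z.1) hab)
    · intro a _
      simp
    · intro j _ hj
      have : j.1 ∉ W := fun hjW => hj ⟨⟨j.1, hjW⟩, by simp, rfl⟩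
      rw [hv j this, mul_zero]
    · intro a _
      rfl
  constructor
  · rintro ⟨h, hu⟩
    refine ⟨h, fun v hv hAv => ?_⟩
    rw [← Matrix.mulVec_injective_iff_isUnit] at hu
    have h0 : (fun i : W => v ⟨i.1, h i.1 i.2⟩) = 0 := by
      apply hu
      rw [Matrix.mulVec_zero]
      funext i
      rw [key h v hv i]
      exact hAv _ i.2
    funext i
    by_cases hi : i.1 ∈ W
    · exact congrFun h0 ⟨i.1, hi⟩
    · exact hv i hi
  · rintro ⟨h, hinj⟩
    have h' : ∀ x ∈ W, x ∈ E := fun x hx => h hx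
    refine ⟨h', ?_⟩
    rw [← Matrix.mulVec_injective_iff_isUnit, ← Matrix.coe_mulVecLin,
      injective_iff_map_eq_zero]
    intro w hw
    have hsupp : ∀ i : E, i.1 ∉ W →
        (fun i : E => if hi : i.1 ∈ W then w ⟨i.1, hi⟩ else 0) i = 0 := by
      intro i hi
      simp [hi]
    have hres : (fun i : W => (fun i : E => if hi : i.1 ∈ W then w ⟨i.1, hi⟩ else 0)
        ⟨i.1, h' i.1 i.2⟩) = w := by
      funext i
      simp
    have hv := hinj _ hsupp (fun i hi => by
      have := key h' _ hsupp ⟨i.1, hi⟩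
      rw [hres] at this
      rw [← this]
      exact congrFun hw ⟨i.1, hi⟩)
    rw [← hres, hv]
    rfl

/-- Principal pivoting: twisting `D(A)` by a feasible set gives the set system of a symmetric matrix. -/
theorem exists_isSymm_mem_ofMatrix_F_iff_symmDiff {E : Finset α} {A : Matrix E E (ZMod 2)}
    (hA : A.IsSymm) {X : Finset α} (hX : X ∈ (ofMatrix E A).F) :
    ∃ A' : Matrix E E (ZMod 2), A'.IsSymm ∧
      ∀ W, W ∈ (ofMatrix E A').F ↔ symmDiff X W ∈ (ofMatrix E A).F := by
  rw [mem_ofMatrix_F_iff] at hX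
  obtain ⟨hXE, hX⟩ := hX
  let M : Matrix E E (ZMod 2) :=
    fun i j => if i.1 ∈ X then A i j else (1 : Matrix E E (ZMod 2)) i j
  let N : Matrix E E (ZMod 2) :=
    fun i j => if i.1 ∈ X then (1 : Matrix E E (ZMod 2)) i j else A i j
  have hM : ∀ v i, M.mulVec v i = if i.1 ∈ X then A.mulVec v i else v i := by
    intro v i
    split_ifs with hi
    · simp [M, Matrix.mulVec, dotProduct, hi]
    · simp [M, Matrix.mulVec, dotProduct, hi, Matrix.one_apply]
  have hN : ∀ v i, N.mulVec v i = if i.1 ∈ X then v i else A.mulVec v i := by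
    intro v i
    split_ifs with hi
    · simp [N, Matrix.mulVec, dotProduct, hi, Matrix.one_apply]
    · simp [N, Matrix.mulVec, dotProduct, hi]
  have hMker : ∀ v, M.mulVec v = 0 → v = 0 := by
    intro v hv
    have hv' : ∀ i, (if i.1 ∈ X then A.mulVec v i else v i) = 0 := fun i => by
      rw [← hM, hv, Pi.zero_apply]
    exact hX v (fun i hi => by simpa [hi] using hv' i) (fun i hi => by simpa [hi] using hv' i)
  have hMu : IsUnit M := by
    rw [← Matrix.mulVec_injective_iff_isUnit, ← Matrix.coe_mulVecLin, injective_iff_map_eq_zero]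
    exact hMker
  have hdet : IsUnit M.det := (Matrix.isUnit_iff_isUnit_det M).1 hMu
  have hMN : M.transpose * N = N.transpose * M := by
    ext j k
    have hl : (M.transpose * N) j k =
        (if k.1 ∈ X then A k j else 0) + (if j.1 ∈ X then 0 else A j k) := by
      have : ∀ i, M i j * N i k = (if k = i then (if k.1 ∈ X then A k j else 0) else 0) +
          (if j = i then (if j.1 ∈ X then 0 else A j k) else 0) := by
        intro i
        simp only [M, N, Matrix.one_apply]
        grind
      simp [Matrix.mul_apply, this, Finset.sum_add_distrib]
    have hr : (N.transpose * M) j k =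
        (if j.1 ∈ X then A j k else 0) + (if k.1 ∈ X then 0 else A k j) := by
      have : ∀ i, N i j * M i k = (if j = i then (if j.1 ∈ X then A j k else 0) else 0) +
          (if k = i then (if k.1 ∈ X then 0 else A k j) else 0) := by
        intro i
        simp only [M, N, Matrix.one_apply]
        grind
      simp [Matrix.mul_apply, this, Finset.sum_add_distrib]
    rw [hl, hr, hA.apply j k]
    split_ifs <;> simp [CharTwo.add_self_eq_zero]
  have hNv : ∀ v, (N * M⁻¹).mulVec (M.mulVec v) = N.mulVec v := by
    intro v
    rw [Matrix.mulVec_mulVec, Matrix.mul_assoc, Matrix.nonsing_inv_mul _ hdet, Matrix.mul_one]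
  refine ⟨N * M⁻¹, ?_, fun W => ?_⟩
  · have hdetT : IsUnit M.transpose.det := by rwa [Matrix.det_transpose]
    rw [Matrix.IsSymm, Matrix.transpose_mul, Matrix.transpose_nonsing_inv]
    calc M.transpose⁻¹ * N.transpose
        = M.transpose⁻¹ * (N.transpose * M) * M⁻¹ := by
          rw [Matrix.mul_assoc, Matrix.mul_assoc, Matrix.mul_nonsing_inv _ hdet, Matrix.mul_one]
      _ = N * M⁻¹ := by
          rw [← hMN, ← Matrix.mul_assoc, Matrix.nonsing_inv_mul _ hdetT, Matrix.one_mul]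
  · rw [mem_ofMatrix_F_iff, mem_ofMatrix_F_iff]
    have hsub : W ⊆ E ↔ symmDiff X W ⊆ E := by
      simp only [Finset.subset_iff, Finset.mem_symmDiff] at hXE ⊢
      grind
    refine and_congr hsub ⟨fun h v h₁ h₂ => ?_, fun h w h₁ h₂ => ?_⟩
    · apply hMker
      apply h
      · intro i hi
        rw [hM]
        split_ifs with hiX
        · exact h₂ i (by simp [Finset.mem_symmDiff, hi, hiX])
        · exact h₁ i (by simp [Finset.mem_symmDiff, hi, hiX])
      · intro i hi
        rw [hNv, hN]
        split_ifs with hiX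
        · exact h₁ i (by simp [Finset.mem_symmDiff, hi, hiX])
        · exact h₂ i (by simp [Finset.mem_symmDiff, hi, hiX])
    · obtain ⟨v, rfl⟩ : ∃ v, M.mulVec v = w :=
        ⟨M⁻¹.mulVec w, by rw [Matrix.mulVec_mulVec, Matrix.mul_nonsing_inv _ hdet,
          Matrix.one_mulVec]⟩
      rw [hNv] at h₂
      have hv : v = 0 := by
        apply h
        · intro i hi
          by_cases hiX : i.1 ∈ X
          · have := h₂ i (by simpa [Finset.mem_symmDiff, hiX] using hi)
            simpa [hN, hiX] using this
          · have := h₁ i (by simpa [Finset.mem_symmDiff, hiX] using hi)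
            simpa [hM, hiX] using this
        · intro i hi
          by_cases hiX : i.1 ∈ X
          · have := h₁ i (by simpa [Finset.mem_symmDiff, hiX] using hi)
            simpa [hM, hiX] using this
          · have := h₂ i (by simpa [Finset.mem_symmDiff, hiX] using hi)
            simpa [hN, hiX] using this
      rw [hv, Matrix.mulVec_zero]

/-- A binary set system is represented by a symmetric matrix relative to each feasible set. -/
theorem IsBinary.exists_isSymm_of_mem {D : SetSystem α} (hB : D.IsBinary) {F : Finset α}
    (hF : F ∈ D.F) :
    ∃ A : Matrix D.E D.E (ZMod 2), A.IsSymm ∧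
      ∀ Y, Y ∈ D.F ↔ symmDiff F Y ∈ (ofMatrix D.E A).F := by
  obtain ⟨F₀, -, A, hA, hD⟩ := hB
  have hmem : ∀ Y, Y ∈ D.F ↔ symmDiff F₀ Y ∈ (ofMatrix D.E A).F := fun Y => by
    rw [← mem_twist_F, ← hD]
  obtain ⟨A', hA', h⟩ := exists_isSymm_mem_ofMatrix_F_iff_symmDiff hA ((hmem F).1 hF)
  refine ⟨A', hA', fun Y => ?_⟩
  rw [h, hmem, symmDiff_assoc, symmDiff_symmDiff_cancel_left]

/-- Restricting a representing matrix to a smaller ground set. -/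
theorem isBinary_of_mem_F_iff {D : SetSystem α} {E : Finset α} (hE : D.E ⊆ E)
    {A : Matrix E E (ZMod 2)} (hA : A.IsSymm) {F : Finset α} (hF : F ∈ D.F) (hFE : F ⊆ D.E)
    (h : ∀ Y, Y ∈ D.F ↔ Y ⊆ D.E ∧ symmDiff F Y ∈ (ofMatrix E A).F) : D.IsBinary := by
  refine ⟨F, hF, A.submatrix (fun i => ⟨i.1, hE i.2⟩) (fun i => ⟨i.1, hE i.2⟩),
    hA.submatrix _, ?_⟩
  have hFeq : D.F = ((ofMatrix D.E
      (A.submatrix (fun i => ⟨i.1, hE i.2⟩) (fun i => ⟨i.1, hE i.2⟩))).twist F).F := by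
    ext Y
    rw [mem_twist_F, h]
    constructor
    · rintro ⟨hY, _, hu⟩
      exact ⟨fun x hx => (Finset.mem_symmDiff.1 hx).elim (fun p => hFE p.1) (fun p => hY p.1), hu⟩
    · rintro ⟨hs, hu⟩
      refine ⟨fun x hx => ?_, fun x hx => hE (hs x hx), hu⟩
      by_cases hxF : x ∈ F
      · exact hFE hxF
      · exact hs x (Finset.mem_symmDiff.2 (Or.inr ⟨hx, hxF⟩))
  obtain ⟨E', 𝓕⟩ := D
  exact congrArg (SetSystem.mk E') hFeq

theorem symmDiff_pair_subset {E F₁ F₂ : Finset α} (h₁ : F₁ ⊆ E) (h₂ : F₂ ⊆ E) {x y : α}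
    (hx : x ∈ symmDiff F₁ F₂) (hy : y ∈ symmDiff F₁ F₂) : symmDiff F₁ {x, y} ⊆ E := by
  intro z hz
  simp only [Finset.mem_symmDiff, Finset.mem_insert, Finset.mem_singleton] at hx hy hz
  grind

theorem IsDeltaMatroid.del {D : SetSystem α} (hD : D.IsDeltaMatroid) {e : α}
    (hne : (D.del e).F.Nonempty) : (D.del e).IsDeltaMatroid := by
  refine ⟨hne, fun F hF => hF.1, ?_⟩
  rintro F₁ ⟨h₁, hF₁⟩ F₂ ⟨h₂, hF₂⟩ x hx
  obtain ⟨y, hy, hxy⟩ := hD.2.2 F₁ hF₁ F₂ hF₂ x hx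
  exact ⟨y, hy, symmDiff_pair_subset h₁ h₂ hx hy, hxy⟩

theorem symmDiff_union_singleton_s13 {F₁ F₂ : Finset α} {e : α} (h₁ : e ∉ F₁) (h₂ : e ∉ F₂) :
    symmDiff (F₁ ∪ {e}) (F₂ ∪ {e}) = symmDiff F₁ F₂ := by
  ext z
  simp only [Finset.mem_symmDiff, Finset.mem_union, Finset.mem_singleton]
  grind

theorem IsDeltaMatroid.contr {D : SetSystem α} (hD : D.IsDeltaMatroid) {e : α}
    (hne : (D.contr e).F.Nonempty) : (D.contr e).IsDeltaMatroid := by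
  refine ⟨hne, fun F hF => hF.1, ?_⟩
  rintro F₁ ⟨h₁, hF₁⟩ F₂ ⟨h₂, hF₂⟩ x hx
  have he₁ : e ∉ F₁ := fun h => Finset.notMem_erase e _ (h₁ h)
  have he₂ : e ∉ F₂ := fun h => Finset.notMem_erase e _ (h₂ h)
  obtain ⟨y, hy, hxy⟩ := hD.2.2 _ hF₁ _ hF₂ x (by rwa [symmDiff_union_singleton_s13 he₁ he₂])
  rw [symmDiff_union_singleton_s13 he₁ he₂] at hy
  refine ⟨y, hy, symmDiff_pair_subset h₁ h₂ hx hy, ?_⟩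
  have : symmDiff F₁ {x, y} ∪ {e} = symmDiff (F₁ ∪ {e}) {x, y} := by
    ext z
    simp only [Finset.mem_symmDiff, Finset.mem_union, Finset.mem_singleton,
      Finset.mem_insert] at hx hy ⊢
    grind
  rwa [this]

theorem IsBinary.del {D : SetSystem α} (hB : D.IsBinary) {e : α}
    (hne : (D.del e).F.Nonempty) : (D.del e).IsBinary := by
  obtain ⟨F, hF⟩ := hne
  obtain ⟨A, hA, h⟩ := hB.exists_isSymm_of_mem hF.2
  exact isBinary_of_mem_F_iff (Finset.erase_subset e D.E) hA hF hF.1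
    fun Y => and_congr_right fun _ => h Y

theorem IsBinary.contr {D : SetSystem α} (hB : D.IsBinary) {e : α}
    (hne : (D.contr e).F.Nonempty) : (D.contr e).IsBinary := by
  obtain ⟨F, hF⟩ := hne
  obtain ⟨A, hA, h⟩ := hB.exists_isSymm_of_mem hF.2
  refine isBinary_of_mem_F_iff (Finset.erase_subset e D.E) hA hF hF.1
    fun Y => and_congr_right fun hY => ?_
  rw [h, symmDiff_union_singleton_s13 (fun h => Finset.notMem_erase e _ (hF.1 h))
    (fun h => Finset.notMem_erase e _ (hY h))]

end SetSystem

/-- every elementary minor (deletion or contraction, with nonempty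
feasible collection) of a binary delta-matroid is a binary delta-matroid. -/
theorem stmt_13 {α : Type*} [DecidableEq α] (D : SetSystem α)
    (hD : D.IsDeltaMatroid) (hB : D.IsBinary) (e : α) (he : e ∈ D.E) :
    ((D.del e).F.Nonempty → (D.del e).IsDeltaMatroid ∧ (D.del e).IsBinary) ∧
    ((D.contr e).F.Nonempty → (D.contr e).IsDeltaMatroid ∧ (D.contr e).IsBinary) := by
  exact ⟨fun hne => ⟨hD.del hne, hB.del hne⟩, fun hne => ⟨hD.contr hne, hB.contr hne⟩⟩
end
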